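/- arXiv:2307.04188 — 3 statements merged into one kernel-verified Lean document; each statement's English description precedes it below -/
import Mathlib

section
/- Fix k ∈ ℕ+ with k ≥ 2 and a real number ω ∈ (0,1]. Let (X_i)_{i∈I} be random variables indexed by a finite set I, let G be any graph on vertex set I, and for J ⊆ I let N(J) := J ∪ {i ∈ I : i is adjacent in G to some j ∈ J}, with N(i_{1:q}) := N({i_1,…,i_q}). Suppose |N(J)| ≤ M for every J ⊆ I with |J| ≤ k. Then there exists a constant C_{k+ω} depending only on k+ω such that for every admissible integer sequence t_1,…,t_k (t_1 = 0, |t_j| ≤ j−1 for all j ∈ [k]): ℛ_ω[t_1,…,t_k] ≤ C_{k+ω} · M^{k−2+ω} · Σ_{i∈I} E[|X_i|^{k−1+ω}]. -/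
open MeasureTheory ProbabilityTheory Filter

noncomputable section

variable {Ω ι : Type*} [MeasurableSpace Ω]

/-- Chains of indices: `i₁ ∈ I`, `i₂ ∈ N(i₁)`, …, `i_q ∈ N(i_{1:q-1})`. -/
inductive DepChain (I : Finset ι) (N : List ι → Finset ι) : List ι → Prop
  | single {i : ι} : i ∈ I → DepChain I N ([i])
  | cons {l : List ι} {i : ι} : DepChain I N l → i ∈ N l → DepChain I N (l ++ [i])

/-- Local dependence conditions [LD-1] … [LD-Q] with dependency neighborhoods `N`. -/
def LocalDep (μ : Measure Ω) (X : ι → Ω → ℝ) (I : Finset ι)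
    (N : List ι → Finset ι) (Q : ℕ) : Prop :=
  ∀ l : List ι, DepChain I N l → l.length ≤ Q →
    IndepFun (fun ω => fun j : {j : ι // j ∉ N l} => X j.val ω)
      (fun ω => fun m : Fin l.length => X (l.get m) ω) μ

/-- Auxiliary, fuelled version of the sign-grouped compositional expectation. -/
def sceAux (μ : Measure Ω) : ℕ → List (ℤ × (Ω → ℝ)) → ℝ
  | _, [] => 1
  | 0, _ :: _ => 1
  | n + 1, a :: rest =>
      (∫ ω, a.2 ω * ((rest.takeWhile fun b => decide (b.1 ≤ 0)).map fun b => b.2 ω).prod ∂μ) *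
        sceAux μ n (rest.dropWhile fun b => decide (b.1 ≤ 0))

/-- Sign-grouped compositional expectation: the factors are grouped into blocks, a new
block starting at each position whose attached integer `t_j` is positive; the value is the
product over the blocks of the expectation of the product of the functions in the block. -/
def sce (μ : Measure Ω) (L : List (ℤ × (Ω → ℝ))) : ℝ := sceAux μ L.length L

/-- Iterated sums `∑_{i₁ ∈ N₁} ⋯ ∑_{i_k ∈ N_k}` where `N₁ = I` and, for `j ≥ 2`,
`N_j = N(i_1, …, i_{|t_j|})` if `t_j ≠ 0` and `N_j = ∅` if `t_j = 0`. -/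
def nestedSum (I : Finset ι) (N : List ι → Finset ι) :
    List ℤ → List ι → (List ι → ℝ) → ℝ
  | [], chosen, F => F chosen
  | t :: ts, chosen, F =>
      ∑ i ∈ (if chosen.isEmpty then I else if t = 0 then (∅ : Finset ι)
          else N (chosen.take t.natAbs)),
        nestedSum I N ts (chosen ++ [i]) F

/-- The `𝒮`-sum `𝒮[t₁, …, t_k]` of Liu–Austern. -/
def Ssum [Inhabited ι] (μ : Measure Ω) (X : ι → Ω → ℝ) (I : Finset ι)
    (N : List ι → Finset ι) (t : List ℤ) : ℝ :=
  nestedSum I N t ([] : List ι) fun chosen =>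
    sce μ (t.zip (chosen.map fun i => X i))

/-- The `𝒯`-sum `𝒯_{f,s}[t₁, …, t_k]` of Liu–Austern: as the `𝒮`-sum, but the last factor
`X_{i_k}` is multiplied by `∂^{k-1} f(W_{i.}[k-s])`, where `W_{i.}[0] = W` and
`W_{i.}[j] = ∑_{i ∈ I ∖ N(i_{1:j})} X_i` for `j ≥ 1`. -/
def Tsum [Inhabited ι] [DecidableEq ι] (μ : Measure Ω) (X : ι → Ω → ℝ) (I : Finset ι)
    (N : List ι → Finset ι) (f : ℝ → ℝ) (s : ℕ) (t : List ℤ) : ℝ :=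
  nestedSum I N t ([] : List ι) fun chosen =>
    sce μ (t.zip ((List.range t.length).map fun r =>
      if r + 1 = t.length then
        fun ω => X (chosen.getD r default) ω *
          iteratedDeriv (t.length - 1) f
            (if t.length - s = 0 then ∑ i ∈ I, X i ω
             else ∑ i ∈ I \ N (chosen.take (t.length - s)), X i ω)
      else X (chosen.getD r default)))

/-- The `ℛ`-sum `ℛ_ω[t₁, …, t_k]` of Liu–Austern: the first `k-1` factors are `|X_{i_r}|`,
and the last factor is `(∑_{i_k ∈ N_k} |X_{i_k}|)^ω`. -/
def RsumT [Inhabited ι] (μ : Measure Ω) (X : ι → Ω → ℝ) (I : Finset ι)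
    (N : List ι → Finset ι) (w : ℝ) (t : List ℤ) : ℝ :=
  nestedSum I N t.dropLast ([] : List ι) fun chosen =>
    sce μ (t.zip ((List.range t.length).map fun r =>
      if r + 1 = t.length then
        fun ω => (∑ i ∈ (if chosen.isEmpty then I
            else if t.getLastD 0 = 0 then (∅ : Finset ι)
            else N (chosen.take (t.getLastD 0).natAbs)), |X i ω|) ^ w
      else fun ω => |X (chosen.getD r default) ω|))

end

/-- Neighborhood of a finite set of vertices in a graph, intersected with the index set `I`:
`N(J) = J ∪ {i ∈ I : i adjacent to some j ∈ J}`. -/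
def graphN {ι : Type*} [DecidableEq ι] (G : SimpleGraph ι) [DecidableRel G.Adj]
    (I : Finset ι) (J : Finset ι) : Finset ι :=
  J ∪ I.filter fun i => ∃ j ∈ J, G.Adj i j

section Holder

variable {Ω : Type*} [MeasurableSpace Ω] {μ : Measure Ω}

/-- Hölder's inequality on a probability space, for nonnegative integrable functions and
exponents with sum at most one. -/
theorem integral_prod_rpow_le_prod_integral_rpow [IsProbabilityMeasure μ] {α : Type*}
    (s : Finset α) {g : α → Ω → ℝ}
    {θ : α → ℝ} (hg : ∀ a ∈ s, ∀ ω, 0 ≤ g a ω) (hgi : ∀ a ∈ s, Integrable (g a) μ)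
    (hθ : ∀ a ∈ s, 0 ≤ θ a) (hsum : ∑ a ∈ s, θ a ≤ 1) :
    ∫ ω, ∏ a ∈ s, g a ω ^ θ a ∂μ ≤ ∏ a ∈ s, (∫ ω, g a ω ∂μ) ^ θ a := by
  have hint : ∀ a ∈ s, 0 ≤ ∫ ω, g a ω ∂μ := fun a ha => integral_nonneg (hg a ha)
  rw [integral_eq_lintegral_of_nonneg_ae]
  · refine ENNReal.toReal_le_of_le_ofReal
      (Finset.prod_nonneg fun a ha => Real.rpow_nonneg (hint a ha) _) ?_
    have key := ENNReal.lintegral_mul_prod_norm_pow_le (μ := μ) s (g := fun _ => 1)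
      (f := fun a ω => ENNReal.ofReal (g a ω)) aemeasurable_const
      (fun a ha => (hgi a ha).1.aemeasurable.ennreal_ofReal) (q := 1 - ∑ a ∈ s, θ a) (p := θ)
      (by ring) (by linarith) hθ
    simp only [ENNReal.one_rpow, one_mul, lintegral_one, measure_univ] at key
    refine (lintegral_congr fun ω => ?_).trans_le (key.trans_eq ?_)
    · rw [ENNReal.ofReal_prod_of_nonneg fun a ha => Real.rpow_nonneg (hg a ha ω) _]
      exact Finset.prod_congr rfl fun a ha =>
        (ENNReal.ofReal_rpow_of_nonneg (hg a ha ω) (hθ a ha)).symm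
    · rw [ENNReal.ofReal_prod_of_nonneg fun a ha => Real.rpow_nonneg (hint a ha) _]
      refine Finset.prod_congr rfl fun a ha => ?_
      rw [← ENNReal.ofReal_rpow_of_nonneg (hint a ha) (hθ a ha),
        ofReal_integral_eq_lintegral_ofReal (hgi a ha) (ae_of_all _ (hg a ha))]
  · exact ae_of_all _ fun ω => Finset.prod_nonneg fun a ha => Real.rpow_nonneg (hg a ha ω) _
  · exact (Finset.aemeasurable_fun_prod s fun a ha =>
      (hgi a ha).1.aemeasurable.pow_const _).aestronglyMeasurable

/-- List version of `integral_prod_rpow_le_prod_integral_rpow`. -/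
theorem integral_list_prod_rpow_le [IsProbabilityMeasure μ] {α : Type*}
    (l : List α) {g : α → Ω → ℝ} {θ : α → ℝ}
    (hg : ∀ a ∈ l, ∀ ω, 0 ≤ g a ω) (hgi : ∀ a ∈ l, Integrable (g a) μ)
    (hθ : ∀ a ∈ l, 0 ≤ θ a) (hsum : (l.map θ).sum ≤ 1) :
    ∫ ω, (l.map fun a => g a ω ^ θ a).prod ∂μ ≤
      (l.map fun a => (∫ ω, g a ω ∂μ) ^ θ a).prod := by
  simp only [← Fin.prod_univ_fun_getElem, ← Fin.sum_univ_fun_getElem] at hsum ⊢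
  exact integral_prod_rpow_le_prod_integral_rpow Finset.univ
    (g := fun i : Fin l.length => g l[i]) (θ := fun i : Fin l.length => θ l[i])
    (fun i _ => hg _ (by simp)) (fun i _ => hgi _ (by simp)) (fun i _ => hθ _ (by simp)) hsum

theorem sceAux_nonneg (n : ℕ) (L : List (ℤ × (Ω → ℝ))) (hL : ∀ b ∈ L, ∀ ω, 0 ≤ b.2 ω) :
    0 ≤ sceAux μ n L := by
  induction n generalizing L with
  | zero => cases L <;> simp [sceAux]
  | succ n ih =>
    cases L with
    | nil => simp [sceAux]
    | cons a rest =>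
      have hrest : ∀ b ∈ rest, ∀ ω, 0 ≤ b.2 ω := fun b hb => hL b (List.mem_cons_of_mem _ hb)
      refine mul_nonneg (integral_nonneg fun ω => mul_nonneg (hL a List.mem_cons_self ω)
        (List.prod_nonneg ?_)) (ih _ fun b hb => hrest b ((List.dropWhile_sublist _).subset hb))
      simp only [List.mem_map]
      rintro _ ⟨b, hb, rfl⟩
      exact hrest b ((List.takeWhile_sublist _).subset hb) ω

theorem sceAux_rpow_le [IsProbabilityMeasure μ] {α : Type*}
    {τ : α → ℤ} {g : α → Ω → ℝ} {θ : α → ℝ} (n : ℕ) (l : List α)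
    (hn : l.length ≤ n) (hg : ∀ a ∈ l, ∀ ω, 0 ≤ g a ω) (hgi : ∀ a ∈ l, Integrable (g a) μ)
    (hθ : ∀ a ∈ l, 0 ≤ θ a) (hsum : (l.map θ).sum ≤ 1) :
    sceAux μ n (l.map fun a => (τ a, fun ω => g a ω ^ θ a)) ≤
      (l.map fun a => (∫ ω, g a ω ∂μ) ^ θ a).prod := by
  induction n generalizing l with
  | zero => simp [List.length_eq_zero_iff.mp (Nat.le_zero.mp hn), sceAux]
  | succ n ih =>
    cases l with
    | nil => simp [sceAux]
    | cons a rest =>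
      set T := rest.takeWhile fun b => decide (τ b ≤ 0) with hT
      set D := rest.dropWhile fun b => decide (τ b ≤ 0) with hD
      have hTD : T ++ D = rest := List.takeWhile_append_dropWhile
      have hsub : ∀ b, b ∈ T ∨ b ∈ D → b ∈ a :: rest := fun b hb =>
        List.mem_cons_of_mem _ (hTD ▸ List.mem_append.mpr hb)
      have hsubT : ∀ b ∈ a :: T, b ∈ a :: rest := fun b hb =>
        (List.mem_cons.mp hb).elim (fun h => h ▸ List.mem_cons_self) fun h => hsub b (.inl h)
      have hsubD : ∀ b ∈ D, b ∈ a :: rest := fun b hb => hsub b (.inr hb)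
      have hsum' : ((a :: T).map θ).sum + (D.map θ).sum ≤ 1 := by
        rw [← List.sum_append, ← List.map_append, List.cons_append, hTD]
        exact hsum
      have hnonneg : ∀ l' : List α, (∀ b ∈ l', b ∈ a :: rest) → 0 ≤ (l'.map θ).sum :=
        fun l' hl' => List.sum_nonneg (by
          simp only [List.mem_map]
          rintro _ ⟨b, hb, rfl⟩
          exact hθ b (hl' b hb))
      have hblock := integral_list_prod_rpow_le (μ := μ) (a :: T) (fun b hb => hg b (hsubT b hb))
        (fun b hb => hgi b (hsubT b hb)) (fun b hb => hθ b (hsubT b hb))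
        (by linarith [hnonneg D hsubD])
      have hrec := ih D (by
          have := congrArg List.length hTD
          simp only [List.length_append, List.length_cons] at this hn
          omega)
        (fun b hb => hg b (hsubD b hb)) (fun b hb => hgi b (hsubD b hb))
        (fun b hb => hθ b (hsubD b hb)) (by linarith [hnonneg (a :: T) hsubT])
      have hsplit : ((a :: rest).map fun a => (∫ ω, g a ω ∂μ) ^ θ a).prod =
          ((a :: T).map fun a => (∫ ω, g a ω ∂μ) ^ θ a).prod *
            (D.map fun a => (∫ ω, g a ω ∂μ) ^ θ a).prod := by
        rw [← List.prod_append, ← List.map_append, List.cons_append, hTD]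
      rw [hsplit]
      simp only [List.map_cons, sceAux, List.takeWhile_map, List.dropWhile_map, List.map_map,
        Function.comp_def, List.prod_cons, ← hT, ← hD] at hblock hrec ⊢
      refine mul_le_mul hblock hrec (sceAux_nonneg _ _ ?_) (mul_nonneg
        (Real.rpow_nonneg (integral_nonneg (hg a List.mem_cons_self)) _) (List.prod_nonneg ?_))
      · simp only [List.mem_map]
        rintro _ ⟨b, hb, rfl⟩ ω
        exact Real.rpow_nonneg (hg b (hsubD b hb) ω) _
      · simp only [List.mem_map]
        rintro _ ⟨b, hb, rfl⟩
        exact Real.rpow_nonneg (integral_nonneg (hg b (hsub b (.inl hb)))) _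

/-- A compositional expectation of nonnegative factors `g_a ^ θ_a` with `∑ θ_a ≤ 1` is at most
`∏ (E g_a) ^ θ_a`. -/
theorem sce_rpow_le [IsProbabilityMeasure μ] {α : Type*}
    {τ : α → ℤ} {g : α → Ω → ℝ} {θ : α → ℝ} (l : List α)
    (hg : ∀ a ∈ l, ∀ ω, 0 ≤ g a ω) (hgi : ∀ a ∈ l, Integrable (g a) μ)
    (hθ : ∀ a ∈ l, 0 ≤ θ a) (hsum : (l.map θ).sum ≤ 1) :
    sce μ (l.map fun a => (τ a, fun ω => g a ω ^ θ a)) ≤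
      (l.map fun a => (∫ ω, g a ω ∂μ) ^ θ a).prod :=
  sceAux_rpow_le _ l (by simp) hg hgi hθ hsum

end Holder

section NestedSum

variable {ι : Type*} {I : Finset ι} {N : List ι → Finset ι}

theorem nestedSum_append_singleton (ts : List ℤ) (t : ℤ) (c : List ι) (F : List ι → ℝ) :
    nestedSum I N (ts ++ [t]) c F = nestedSum I N ts c fun c' =>
      ∑ i ∈ (if c'.isEmpty then I else if t = 0 then (∅ : Finset ι) else N (c'.take t.natAbs)),
        F (c' ++ [i]) := by
  induction ts generalizing c with
  | nil => rfl
  | cons s ts ih => simp only [List.cons_append, nestedSum, ih]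

theorem nestedSum_add (ts : List ℤ) (c : List ι) (F F' : List ι → ℝ) :
    nestedSum I N ts c (fun c' => F c' + F' c') = nestedSum I N ts c F + nestedSum I N ts c F' := by
  induction ts generalizing c with
  | nil => rfl
  | cons s ts ih => simp only [nestedSum, ih, Finset.sum_add_distrib]

theorem nestedSum_const_mul (ts : List ℤ) (c : List ι) (a : ℝ) (F : List ι → ℝ) :
    nestedSum I N ts c (fun c' => a * F c') = a * nestedSum I N ts c F := by
  induction ts generalizing c with
  | nil => rfl
  | cons s ts ih => simp only [nestedSum, ih, Finset.mul_sum]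

theorem nestedSum_sum {α : Type*} (s : Finset α) (ts : List ℤ) (c : List ι)
    (F : α → List ι → ℝ) :
    nestedSum I N ts c (fun c' => ∑ a ∈ s, F a c') = ∑ a ∈ s, nestedSum I N ts c (F a) := by
  induction ts generalizing c with
  | nil => rfl
  | cons t ts ih =>
    simp only [nestedSum, ih]
    exact Finset.sum_comm

theorem nestedSum_mono (hN : ∀ l : List ι, (∀ i ∈ l, i ∈ I) → N l ⊆ I) (ts : List ℤ)
    (c : List ι) (hc : ∀ i ∈ c, i ∈ I) {F F' : List ι → ℝ}
    (h : ∀ c' : List ι, c'.length = c.length + ts.length → (∀ i ∈ c', i ∈ I) → F c' ≤ F' c') :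
    nestedSum I N ts c F ≤ nestedSum I N ts c F' := by
  induction ts generalizing c with
  | nil => exact h c rfl hc
  | cons t ts ih =>
    refine Finset.sum_le_sum fun i hi => ih _ ?_ fun c' hc' hI => h c' ?_ hI
    · have hiI : i ∈ I := by
        split_ifs at hi
        · exact hi
        · simp at hi
        · exact hN _ (fun j hj => hc j (List.mem_of_mem_take hj)) hi
      simpa [or_imp, forall_and] using ⟨hc, hiI⟩
    · simp only [List.length_append, List.length_cons, List.length_nil] at hc' ⊢
      omega

end NestedSum

section GraphNeighborhood

variable {ι : Type*} [DecidableEq ι] {G : SimpleGraph ι} [DecidableRel G.Adj] {I : Finset ι}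

theorem graphN_subset {J : Finset ι} (hJ : J ⊆ I) : graphN G I J ⊆ I :=
  Finset.union_subset hJ (Finset.filter_subset _ _)

theorem graphN_toFinset_subset (l : List ι) (hl : ∀ i ∈ l, i ∈ I) :
    graphN G I l.toFinset ⊆ I :=
  graphN_subset fun i hi => hl i (List.mem_toFinset.mp hi)

theorem mem_graphN_singleton_comm {i j : ι} (hi : i ∈ I) (hj : j ∈ I) :
    i ∈ graphN G I {j} ↔ j ∈ graphN G I {i} := by
  simp [graphN, hi, hj, eq_comm, G.adj_comm]

theorem exists_mem_graphN_singleton {J : Finset ι} {i : ι} (hi : i ∈ graphN G I J) :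
    ∃ j ∈ J, i ∈ graphN G I {j} := by
  rcases Finset.mem_union.mp hi with h | h
  · exact ⟨i, h, by simp [graphN]⟩
  · obtain ⟨hiI, j, hj, hij⟩ := Finset.mem_filter.mp h
    exact ⟨j, hj, by simp [graphN, hiI, hij]⟩

theorem sum_sum_graphN_singleton_le {M : ℕ} (hM : ∀ i ∈ I, (graphN G I {i}).card ≤ M)
    {b : ι → ℝ} (hb : ∀ i ∈ I, 0 ≤ b i) :
    ∑ j ∈ I, ∑ i ∈ graphN G I {j}, b i ≤ M * ∑ i ∈ I, b i := by
  have hsub : ∀ j ∈ I, graphN G I {j} ⊆ I := fun j hj => graphN_subset (by simpa using hj)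
  rw [Finset.sum_comm' (t' := I) (s' := fun i => graphN G I {i}), Finset.mul_sum]
  · refine Finset.sum_le_sum fun i hi => ?_
    rw [Finset.sum_const, nsmul_eq_mul]
    exact mul_le_mul_of_nonneg_right (by exact_mod_cast hM i hi) (hb i hi)
  · refine fun j i => ⟨fun ⟨hj, hi⟩ => ?_, fun ⟨hj, hi⟩ => ?_⟩
    · exact ⟨(mem_graphN_singleton_comm (hsub j hj hi) hj).mp hi, hsub j hj hi⟩
    · exact ⟨hsub i hi hj, (mem_graphN_singleton_comm hi (hsub i hi hj)).mpr hj⟩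

theorem sum_graphN_toFinset_take_le [Inhabited ι] {c : List ι} (hc : ∀ i ∈ c, i ∈ I) (q : ℕ)
    {b : ι → ℝ} (hb : ∀ i ∈ I, 0 ≤ b i) :
    ∑ i ∈ graphN G I (c.take q).toFinset, b i ≤
      ∑ r ∈ Finset.range c.length, ∑ i ∈ graphN G I {c.getD r default}, b i := by
  have hmem : ∀ r ∈ Finset.range c.length, c.getD r default ∈ I := fun r hr => by
    rw [List.getD_eq_getElem _ _ (Finset.mem_range.mp hr)]
    exact hc _ (List.getElem_mem _)
  have hsub : ∀ r ∈ Finset.range c.length, graphN G I {c.getD r default} ⊆ I := fun r hr =>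
    graphN_subset (by simpa using hmem r hr)
  calc ∑ i ∈ graphN G I (c.take q).toFinset, b i
      ≤ ∑ i ∈ graphN G I (c.take q).toFinset, ∑ r ∈ Finset.range c.length,
          if i ∈ graphN G I {c.getD r default} then b i else 0 := by
        refine Finset.sum_le_sum fun i hi => ?_
        have hbi : 0 ≤ b i := hb i (graphN_toFinset_subset _
          (fun j hj => hc j (List.mem_of_mem_take hj)) hi)
        obtain ⟨j, hj, hij⟩ := exists_mem_graphN_singleton hi
        obtain ⟨r, hr, rfl⟩ := List.getElem_of_mem (List.mem_of_mem_take (List.mem_toFinset.mp hj))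
        rw [← List.getD_eq_getElem _ default hr] at hij
        refine (if_pos hij).symm.trans_le (Finset.single_le_sum
          (f := fun r => if i ∈ graphN G I {c.getD r default} then b i else 0)
          (fun r _ => ?_) (Finset.mem_range.mpr hr))
        positivity
    _ = ∑ r ∈ Finset.range c.length, ∑ i ∈ graphN G I (c.take q).toFinset with
          i ∈ graphN G I {c.getD r default}, b i := by
        rw [Finset.sum_comm]
        simp only [Finset.sum_filter]
    _ ≤ _ := Finset.sum_le_sum fun r hr => Finset.sum_le_sum_of_subset_of_nonneg
        (fun i hi => (Finset.mem_filter.mp hi).2) fun i hi _ => hb i (hsub r hr hi)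

/-- Along a chain of `m + 1` indices each marginal sum is at most `(m + 1)! M ^ m` times the sum
over `I`: as the graph is symmetric, chains can be counted starting from any of their indices. -/
theorem nestedSum_getD_le [Inhabited ι] {k M : ℕ}
    (hM : ∀ J : Finset ι, J ⊆ I → J.card ≤ k → (graphN G I J).card ≤ M) (m : ℕ)
    (ts : List ℤ) (hts : ts.length = m + 1) (hmk : m ≤ k) {b : ι → ℝ} (hb : ∀ i ∈ I, 0 ≤ b i)
    (j : ℕ) (hj : j ≤ m) :
    nestedSum I (fun l => graphN G I l.toFinset) ts [] (fun c => b (c.getD j default)) ≤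
      (m + 1).factorial * (M : ℝ) ^ m * ∑ i ∈ I, b i := by
  induction m generalizing ts b j with
  | zero =>
    obtain ⟨t, rfl⟩ := List.length_eq_one_iff.mp hts
    obtain rfl : j = 0 := by omega
    simp [nestedSum]
  | succ m ih =>
    obtain ⟨ts, t, rfl⟩ : ∃ ts' t, ts = ts' ++ [t] :=
      ⟨_, _, (List.dropLast_append_getLast (List.ne_nil_of_length_pos (by omega))).symm⟩
    have hts' : ts.length = m + 1 := by simpa using hts
    have hIb : 0 ≤ ∑ i ∈ I, b i := Finset.sum_nonneg hb
    rw [nestedSum_append_singleton]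
    rcases hj.lt_or_eq with hj | rfl
    · calc _ ≤ nestedSum I (fun l => graphN G I l.toFinset) ts []
              (fun c => M * b (c.getD j default)) := by
            refine nestedSum_mono graphN_toFinset_subset _ _ (by simp) fun c hc hcI => ?_
            have hjc : j < c.length := by simp only [hc, List.length_nil]; omega
            have hbj : 0 ≤ b (c.getD j default) := by
              rw [List.getD_eq_getElem _ _ hjc]
              exact hb _ (hcI _ (List.getElem_mem _))
            have hne : c.isEmpty = false := by
              rw [List.isEmpty_eq_false_iff]
              exact List.ne_nil_of_length_pos (by omega)
            simp only [List.getD_append _ _ _ _ hjc, Finset.sum_const, nsmul_eq_mul, hne,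
              Bool.false_eq_true, if_false]
            refine mul_le_mul_of_nonneg_right ?_ hbj
            split_ifs
            · simp
            · refine Nat.cast_le.mpr (hM _ (fun i hi => hcI i (List.mem_of_mem_take
                (List.mem_toFinset.mp hi))) ((List.toFinset_card_le _).trans ?_))
              simp only [List.length_take, hc, List.length_nil]
              omega
        _ ≤ M * ((m + 1).factorial * (M : ℝ) ^ m * ∑ i ∈ I, b i) := by
            rw [nestedSum_const_mul]
            exact mul_le_mul_of_nonneg_left (ih ts hts' (by omega) hb j (by omega)) (by positivity)
        _ = (m + 1).factorial * ((M : ℝ) ^ (m + 1) * ∑ i ∈ I, b i) := by ring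
        _ ≤ (m + 1 + 1).factorial * ((M : ℝ) ^ (m + 1) * ∑ i ∈ I, b i) := by
            gcongr
            omega
        _ = _ := by ring
    · have hB : ∀ i ∈ I, 0 ≤ ∑ i' ∈ graphN G I {i}, b i' := fun i hi =>
        Finset.sum_nonneg fun i' hi' => hb i' (graphN_subset (by simpa using hi) hi')
      calc _ ≤ nestedSum I (fun l => graphN G I l.toFinset) ts [] (fun c =>
              ∑ r ∈ Finset.range (m + 1), ∑ i ∈ graphN G I {c.getD r default}, b i) := by
            refine nestedSum_mono graphN_toFinset_subset _ _ (by simp) fun c hc hcI => ?_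
            have hcm : c.length = m + 1 := by simp only [hc, List.length_nil]; omega
            have hne : c.isEmpty = false := by
              rw [List.isEmpty_eq_false_iff]
              exact List.ne_nil_of_length_pos (by omega)
            have hlast : ∀ i, (c ++ [i]).getD (m + 1) default = i := fun i => by
              rw [List.getD_append_right _ _ _ _ hcm.le]
              simp [hcm]
            simp only [hlast, hne, Bool.false_eq_true, if_false]
            split_ifs
            · simp only [Finset.sum_empty]
              refine Finset.sum_nonneg fun r hr => hB _ ?_
              rw [List.getD_eq_getElem _ _ (by rw [hcm]; exact Finset.mem_range.mp hr)]
              exact hcI _ (List.getElem_mem _)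
            · rw [← hcm]
              exact sum_graphN_toFinset_take_le hcI _ hb
        _ ≤ ∑ r ∈ Finset.range (m + 1), (m + 1).factorial * (M : ℝ) ^ m *
              (M * ∑ i ∈ I, b i) := by
            rw [nestedSum_sum]
            refine Finset.sum_le_sum fun r hr => (ih ts hts' (by omega) hB r
              (Nat.lt_succ_iff.mp (Finset.mem_range.mp hr))).trans ?_
            refine mul_le_mul_of_nonneg_left (sum_sum_graphN_singleton_le
              (fun i hi => hM _ (by simpa using hi) ?_) hb) (by positivity)
            rw [Finset.card_singleton]
            omega
        _ = (m + 1) * ((m + 1).factorial * ((M : ℝ) ^ (m + 1) * ∑ i ∈ I, b i)) := by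
            rw [Finset.sum_const, Finset.card_range, nsmul_eq_mul]
            push_cast
            ring
        _ ≤ (m + 1 + 1) * ((m + 1).factorial * ((M : ℝ) ^ (m + 1) * ∑ i ∈ I, b i)) := by
            gcongr
            linarith
        _ = _ := by
            rw [Nat.factorial_succ (m + 1)]
            push_cast
            ring

end GraphNeighborhood

section Summand

variable {Ω ι : Type*} [MeasurableSpace Ω] {μ : Measure Ω}

theorem rpow_sum_abs_le {T : Finset ι} {M : ℕ} (hT : T.card ≤ M) {p : ℝ} (hp : 1 ≤ p)
    (x : ι → ℝ) : (∑ i ∈ T, |x i|) ^ p ≤ (M : ℝ) ^ (p - 1) * ∑ i ∈ T, |x i| ^ p := by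
  refine (Real.rpow_sum_le_const_mul_sum_rpow T x hp).trans ?_
  have : 0 ≤ p - 1 := by linarith
  gcongr

theorem integrable_rpow_sum_abs {X : ι → Ω → ℝ} (hX : ∀ i, Measurable (X i)) (T : Finset ι)
    {p : ℝ} (hp : 1 ≤ p) (hi : ∀ i ∈ T, Integrable (fun ω => |X i ω| ^ p) μ) :
    Integrable (fun ω => (∑ i ∈ T, |X i ω|) ^ p) μ := by
  refine ((integrable_finsetSum T hi).const_mul ((T.card : ℝ) ^ (p - 1))).mono' ?_
    (ae_of_all _ fun ω => ?_)
  · exact ((Finset.measurable_fun_sum T fun i _ => (hX i).abs).pow_const p).aestronglyMeasurable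
  · rw [Real.norm_of_nonneg (by positivity)]
    exact rpow_sum_abs_le le_rfl hp fun i => X i ω

theorem integral_rpow_sum_abs_le {X : ι → Ω → ℝ} (hX : ∀ i, Measurable (X i)) {T : Finset ι}
    {M : ℕ} (hT : T.card ≤ M) {p : ℝ} (hp : 1 ≤ p)
    (hi : ∀ i ∈ T, Integrable (fun ω => |X i ω| ^ p) μ) :
    ∫ ω, (∑ i ∈ T, |X i ω|) ^ p ∂μ ≤ (M : ℝ) ^ (p - 1) * ∑ i ∈ T, ∫ ω, |X i ω| ^ p ∂μ := by
  rw [← integral_finsetSum T hi, ← integral_const_mul]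
  exact integral_mono (integrable_rpow_sum_abs hX T hp hi)
    ((integrable_finsetSum T hi).const_mul _) fun ω => rpow_sum_abs_le hT hp fun i => X i ω

/-- Bound of a single summand of an `ℛ`-sum by `p`-th absolute moments, `p = m + w`, obtained from
Hölder's inequality and the weighted inequality of arithmetic and geometric means. -/
theorem sce_rsum_summand_le [IsProbabilityMeasure μ] {X : ι → Ω → ℝ}
    (hX : ∀ i, Measurable (X i)) {m : ℕ} (hm : 1 ≤ m) {w : ℝ} (hw : 0 < w) {t : List ℤ}
    (ht : t.length = m + 1) {c : ℕ → ι} {T : Finset ι} {M : ℕ} (hM : 0 < M) (hT : T.card ≤ M)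
    (hc : ∀ r < m, Integrable (fun ω => |X (c r) ω| ^ (m + w)) μ)
    (hi : ∀ i ∈ T, Integrable (fun ω => |X i ω| ^ (m + w)) μ) :
    sce μ (t.zip ((List.range t.length).map fun r =>
      if r + 1 = t.length then fun ω => (∑ i ∈ T, |X i ω|) ^ w
      else fun ω => |X (c r) ω|)) ≤
      (M : ℝ) ^ w * (∑ r ∈ Finset.range m, 1 / (m + w) * ∫ ω, |X (c r) ω| ^ (m + w) ∂μ +
        w / (m + w) * ((M : ℝ)⁻¹ * ∑ i ∈ T, ∫ ω, |X i ω| ^ (m + w) ∂μ)) := by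
  have hm' : (1 : ℝ) ≤ m := by exact_mod_cast hm
  have hM' : (0 : ℝ) < M := by exact_mod_cast hM
  obtain ⟨p, hp⟩ : ∃ p : ℝ, p = m + w := ⟨_, rfl⟩
  rw [← hp] at hc hi ⊢
  have hp1 : 1 ≤ p := by linarith
  have hp0 : p ≠ 0 := by linarith
  set g : ℕ → Ω → ℝ := fun r ω =>
    if r = m then (∑ i ∈ T, |X i ω|) ^ p else |X (c r) ω| ^ p with hg
  set θ : ℕ → ℝ := fun r => if r = m then w / p else 1 / p with hθ
  have hgm : ∀ r < m, g r = fun ω => |X (c r) ω| ^ p := fun r hr => by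
    simp only [hg, if_neg hr.ne]
  have hθm : ∀ r < m, θ r = 1 / p := fun r hr => if_neg hr.ne
  have hgm' : g m = fun ω => (∑ i ∈ T, |X i ω|) ^ p := by simp only [hg, if_true]
  have hθm' : θ m = w / p := if_pos rfl
  have hg0 : ∀ r ω, 0 ≤ g r ω := fun r ω => by
    simp only [hg]
    split_ifs <;> positivity
  have hθ0 : ∀ r, 0 ≤ θ r := fun r => by
    simp only [hθ]
    split_ifs <;> positivity
  have hgi : ∀ r ∈ List.range (m + 1), Integrable (g r) μ := fun r hr => by
    rcases (Nat.lt_succ_iff.mp (List.mem_range.mp hr)).lt_or_eq with h | rfl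
    · rw [hgm r h]
      exact hc r h
    · rw [hgm']
      exact integrable_rpow_sum_abs hX T hp1 hi
  have hθsum : ∑ r ∈ Finset.range (m + 1), θ r = 1 := by
    rw [Finset.sum_range_succ, hθm',
      Finset.sum_congr rfl fun r hr => hθm r (Finset.mem_range.mp hr), Finset.sum_const,
      Finset.card_range, nsmul_eq_mul]
    field_simp
    exact hp.symm
  have hlist : t.zip ((List.range t.length).map fun r =>
      if r + 1 = t.length then fun ω => (∑ i ∈ T, |X i ω|) ^ w else fun ω => |X (c r) ω|) =
      (List.range (m + 1)).map fun r => (t.getD r 0, fun ω => g r ω ^ θ r) := by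
    refine List.ext_getElem (by simp [ht]) fun r h₁ h₂ => ?_
    have hr : r < t.length := by simp at h₁; exact h₁
    simp only [List.getElem_zip, List.getElem_map, List.getElem_range,
      List.getD_eq_getElem _ _ hr, ht, Nat.add_right_cancel_iff, Prod.mk.injEq, true_and]
    rcases eq_or_ne r m with rfl | hrm
    · funext ω
      rw [if_pos rfl, hgm', hθm', ← Real.rpow_mul (by positivity), mul_div_cancel₀ _ hp0]
    · funext ω
      have hr' : r < m := by omega
      rw [if_neg hrm, hgm r hr', hθm r hr', ← Real.rpow_mul (by positivity),
        mul_div_cancel₀ _ hp0, Real.rpow_one]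
  rw [hlist]
  set z : ℕ → ℝ := fun r =>
    if r = m then (∫ ω, g m ω ∂μ) / (M : ℝ) ^ p else ∫ ω, g r ω ∂μ with hz
  have hint : ∀ r, 0 ≤ ∫ ω, g r ω ∂μ := fun r => integral_nonneg (hg0 r)
  have hzm : ∀ r < m, z r = ∫ ω, g r ω ∂μ := fun r hr => if_neg hr.ne
  have hzm' : z m = (∫ ω, g m ω ∂μ) / (M : ℝ) ^ p := if_pos rfl
  have hz0 : ∀ r, 0 ≤ z r := fun r => by
    simp only [hz]
    split_ifs
    · exact div_nonneg (hint m) (by positivity)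
    · exact hint r
  have hlast : z m ≤ (M : ℝ)⁻¹ * ∑ i ∈ T, ∫ ω, |X i ω| ^ p ∂μ := by
    rw [hzm', hgm', div_le_iff₀ (by positivity)]
    refine (integral_rpow_sum_abs_le hX hT hp1 hi).trans_eq ?_
    rw [Real.rpow_sub_one hM'.ne']
    ring
  calc _ ≤ ((List.range (m + 1)).map fun r => (∫ ω, g r ω ∂μ) ^ θ r).prod :=
        sce_rpow_le _ (fun r _ => hg0 r) hgi (fun r _ => hθ0 r) hθsum.le
    _ = ∏ r ∈ Finset.range (m + 1), (∫ ω, g r ω ∂μ) ^ θ r := rfl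
    _ = (M : ℝ) ^ w * ∏ r ∈ Finset.range (m + 1), z r ^ θ r := by
        rw [Finset.prod_range_succ, Finset.prod_range_succ, hzm', hθm',
          Real.div_rpow (hint m) (by positivity), ← Real.rpow_mul hM'.le,
          mul_div_cancel₀ _ hp0, Finset.prod_congr rfl fun r hr => by
            rw [← hzm r (Finset.mem_range.mp hr)]]
        have : (M : ℝ) ^ w ≠ 0 := by positivity
        field_simp
    _ ≤ (M : ℝ) ^ w * ∑ r ∈ Finset.range (m + 1), θ r * z r := by
        gcongr
        exact Real.geom_mean_le_arith_mean_weighted _ θ z (fun r _ => hθ0 r) hθsum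
          fun r _ => hz0 r
    _ ≤ _ := by
        rw [Finset.sum_range_succ, hθm', Finset.sum_congr rfl fun r hr => by
          rw [hθm r (Finset.mem_range.mp hr), hzm r (Finset.mem_range.mp hr),
            hgm r (Finset.mem_range.mp hr)]]
        gcongr

end Summand

/-- **Control of `ℛ`-sums** (Liu–Austern, Proposition C.1).  If the neighborhoods (with
respect to any graph `G` on `I`) of sets of at most `k` vertices have cardinality at most
`M`, then for every admissible sequence `t₁,…,t_k`,
`ℛ_ω[t₁,…,t_k] ≤ C_{k+ω} M^{k-2+ω} ∑_{i ∈ I} E[|X_i|^{k-1+ω}]`. -/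
theorem rsum_control (k : ℕ) (hk : 2 ≤ k) (w : ℝ) (hw : 0 < w) (hw1 : w ≤ 1) :
    ∃ C : ℝ, 0 < C ∧
    ∀ (Ω ι : Type) (_ : MeasurableSpace Ω) (_ : Inhabited ι) (_ : DecidableEq ι)
      (μ : Measure Ω), IsProbabilityMeasure μ →
      ∀ (I : Finset ι) (X : ι → Ω → ℝ) (G : SimpleGraph ι) (_ : DecidableRel G.Adj)
        (M : ℕ),
        (∀ i, Measurable (X i)) →
        (∀ i ∈ I, Integrable (fun ω => |X i ω| ^ ((k : ℝ) - 1 + w)) μ) →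
        (∀ J : Finset ι, J ⊆ I → J.card ≤ k → (graphN G I J).card ≤ M) →
        ∀ t : List ℤ, t.length = k → (∀ j, j < k → (t.getD j 0).natAbs ≤ j) →
          RsumT μ X I (fun l => graphN G I l.toFinset) w t ≤
            C * (M : ℝ) ^ ((k : ℝ) - 2 + w) *
              ∑ i ∈ I, ∫ ω, |X i ω| ^ ((k : ℝ) - 1 + w) ∂μ := by
  refine ⟨k.factorial, by positivity, ?_⟩
  intro Ω ι _ _ _ μ _ I X G _ M hX hi hM t ht _
  obtain ⟨m, rfl⟩ : ∃ m, k = m + 1 := ⟨k - 1, by omega⟩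
  have hm : 1 ≤ m := by omega
  have hpow : ((m + 1 : ℕ) : ℝ) - 1 + w = m + w := by push_cast; ring
  have hpow' : ((m + 1 : ℕ) : ℝ) - 2 + w = w + (m - 1 : ℝ) := by push_cast; ring
  rw [hpow, hpow']
  rw [hpow] at hi
  have htd : t.dropLast.length = m := by simp [ht]
  rcases I.eq_empty_or_nonempty with rfl | ⟨i₀, hi₀⟩
  · obtain ⟨s, ts, hts⟩ := List.exists_cons_of_length_pos (l := t.dropLast) (by omega)
    simp [RsumT, hts, nestedSum]
  have hMpos : 0 < M := (Finset.card_pos.mpr ⟨i₀, by simp [graphN]⟩).trans_le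
    (hM {i₀} (by simpa using hi₀) (by simp))
  have hM0 : (0 : ℝ) < M := by exact_mod_cast hMpos
  have hp0 : (0 : ℝ) < m + w := by positivity
  set A : ι → ℝ := fun i => ∫ ω, |X i ω| ^ (m + w) ∂μ with hA
  have hA0 : ∀ i ∈ I, 0 ≤ A i := fun i _ => integral_nonneg fun ω => by positivity
  set N : List ι → Finset ι := fun l => graphN G I l.toFinset with hN
  calc RsumT μ X I N w t
      ≤ nestedSum I N t.dropLast [] fun c => (M : ℝ) ^ w *
          (∑ r ∈ Finset.range m, 1 / (m + w) * A (c.getD r default) + w / (m + w) * ((M : ℝ)⁻¹ *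
            ∑ i ∈ (if c.isEmpty then I else if t.getLastD 0 = 0 then (∅ : Finset ι)
              else N (c.take (t.getLastD 0).natAbs)), A ((c ++ [i]).getD m default))) := by
        refine nestedSum_mono graphN_toFinset_subset _ _ (by simp) fun c hc hcI => ?_
        have hcm : c.length = m := by simpa [htd] using hc
        have hne : c.isEmpty = false := by
          rw [List.isEmpty_eq_false_iff]
          exact List.ne_nil_of_length_pos (by omega)
        have hlast : ∀ i, (c ++ [i]).getD m default = i := fun i => by
          rw [List.getD_append_right _ _ _ _ hcm.le]
          simp [hcm]
        have hsub : ∀ q, ∀ i ∈ (c.take q).toFinset, i ∈ I := fun q i hi =>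
          hcI i (List.mem_of_mem_take (List.mem_toFinset.mp hi))
        simp only [hlast, hne, Bool.false_eq_true, if_false]
        refine sce_rsum_summand_le hX hm hw ht hMpos ?_ (fun r hr => ?_) fun i hi' => ?_
        · split_ifs
          · simp
          · refine hM _ (hsub _) ((List.toFinset_card_le _).trans ?_)
            rw [List.length_take]
            omega
        · rw [List.getD_eq_getElem _ _ (by omega)]
          exact hi _ (hcI _ (List.getElem_mem _))
        · split_ifs at hi'
          · simp at hi'
          · exact hi i (graphN_subset (hsub _) hi')
    _ = (M : ℝ) ^ w * (∑ r ∈ Finset.range m, 1 / (m + w) *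
          nestedSum I N t.dropLast [] (fun c => A (c.getD r default)) + w / (m + w) * ((M : ℝ)⁻¹ *
            nestedSum I N (t.dropLast ++ [t.getLastD 0]) []
              (fun c => A (c.getD m default)))) := by
        simp only [nestedSum_append_singleton, nestedSum_const_mul, nestedSum_add, nestedSum_sum]
    _ ≤ (M : ℝ) ^ w * (∑ r ∈ Finset.range m, 1 / (m + w) *
          ((m + 1).factorial * (M : ℝ) ^ ((m : ℝ) - 1) * ∑ i ∈ I, A i) + w / (m + w) * ((M : ℝ)⁻¹ *
            ((m + 1).factorial * (M : ℝ) ^ m * ∑ i ∈ I, A i))) := by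
        gcongr with r hr
        · have hr' := Finset.mem_range.mp hr
          refine (nestedSum_getD_le hM (m - 1) _ (by omega) (by omega) hA0 r (by omega)).trans ?_
          rw [Nat.sub_add_cancel hm, ← Nat.cast_pred hm, Real.rpow_natCast]
          have := Finset.sum_nonneg hA0
          gcongr
          omega
        · exact nestedSum_getD_le hM m _ (by simp [ht]) (by omega) hA0 m le_rfl
    _ = _ := by
        rw [Finset.sum_const, Finset.card_range, nsmul_eq_mul, Real.rpow_add hM0,
          Real.rpow_sub_one hM0.ne', Real.rpow_natCast]
        field_simp
end

section
/- Fix k ∈ ℕ+ with k ≥ 2. Let G = (I, E) be a graph and for J ⊆ I let N(J) := J ∪ {i ∈ I : i is adjacent in G to some j ∈ J}, with N(i_{1:q}) := N({i_1,…,i_q}). Suppose (i_1,…,i_k) is a tuple such that i_1 ∈ I, i_2 ∈ N(i_1), …, i_k ∈ N(i_{1:(k−1)}). Then for any 1 ≤ h ≤ k there exists a permutation π of {1,…,k} such that π(1) = h, i_{π(1)} ∈ I, i_{π(2)} ∈ N(i_{π(1)}), …, i_{π(k)} ∈ N(i_{π(1)},…,i_{π(k−1)}). -/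
/-- Neighborhood of a finite set of vertices in a graph:
`N(J) = J ∪ {i : i adjacent to some j ∈ J}`. -/
def graphNbhd {ι : Type*} [Fintype ι] [DecidableEq ι] (G : SimpleGraph ι)
    [DecidableRel G.Adj] (J : Finset ι) : Finset ι :=
  J ∪ Finset.univ.filter fun i => ∃ j ∈ J, G.Adj i j

theorem mem_graphNbhd_image_iff {ι κ : Type*} [Fintype ι] [DecidableEq ι] (G : SimpleGraph ι)
    [DecidableRel G.Adj] (f : κ → ι) (S : Finset κ) (x : ι) :
    x ∈ graphNbhd G (S.image f) ↔ ∃ m ∈ S, x = f m ∨ G.Adj x (f m) := by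
  simp only [graphNbhd, Finset.mem_union, Finset.mem_image, Finset.mem_filter, Finset.mem_univ,
    true_and]
  grind

/-- If every nonzero element of `Fin k` is related to a smaller one, then `Fin k` is connected:
every nonempty proper subset is related to its complement. -/
theorem exists_rel_notMem_of_chain {k : ℕ} {R : Fin k → Fin k → Prop}
    (hsymm : ∀ a b, R a b → R b a)
    (hchain : ∀ j : Fin k, 0 < (j : ℕ) → ∃ m < j, R j m) {S : Set (Fin k)}
    (hne : S.Nonempty) (hproper : S ≠ Set.univ) : ∃ a ∉ S, ∃ b ∈ S, R a b := by
  by_contra! hclosed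
  obtain ⟨b, hb⟩ := hne
  have hiff (n : ℕ) (hn : n < k) : (⟨n, hn⟩ : Fin k) ∈ S ↔ (⟨0, by omega⟩ : Fin k) ∈ S := by
    induction n using Nat.strong_induction_on with
    | _ n ih =>
      rcases Nat.eq_zero_or_pos n with rfl | hpos
      · rfl
      · obtain ⟨m, hm, hR⟩ := hchain ⟨n, hn⟩ hpos
        rw [← ih m hm m.isLt]
        constructor
        · intro hnS
          by_contra hmS
          exact hclosed m hmS _ hnS (hsymm _ _ hR)
        · intro hmS
          by_contra hnS
          exact hclosed _ hnS m hmS hR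
  exact hproper (Set.eq_univ_of_forall fun a =>
    (hiff a a.isLt).2 ((hiff b b.isLt).1 hb))

/-- An enumeration of a finite connected set can be started at any point, so that every later
element is related to an earlier one. -/
theorem exists_perm_chain_of_connected {k : ℕ} {R : Fin k → Fin k → Prop}
    (hconn : ∀ S : Set (Fin k), S.Nonempty → S ≠ Set.univ → ∃ a ∉ S, ∃ b ∈ S, R a b)
    (h : Fin k) (hk : 0 < k) :
    ∃ π : Equiv.Perm (Fin k), π ⟨0, hk⟩ = h ∧
      ∀ j : Fin k, 0 < (j : ℕ) → ∃ m < j, R (π j) (π m) := by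
  have hprefix (n : ℕ) (hn : n + 1 ≤ k) : ∃ f : ℕ → Fin k, f 0 = h ∧
      Set.InjOn f (Set.Iio (n + 1)) ∧
      ∀ j < n + 1, 0 < j → ∃ m < j, R (f j) (f m) := by
    induction n with
    | zero =>
      refine ⟨fun _ => h, rfl, ?_, by omega⟩
      intro a ha b hb _
      simp only [Set.mem_Iio] at ha hb
      omega
    | succ n ih =>
      obtain ⟨f, hf0, hinj, hf⟩ := ih (by omega)
      have hproper : f '' Set.Iio (n + 1) ≠ Set.univ := by
        intro heq
        have hcard := hinj.ncard_image
        rw [heq, Set.ncard_univ, Nat.card_fin, ← Finset.coe_Iio, Set.ncard_coe_finset,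
          Nat.card_Iio] at hcard
        omega
      obtain ⟨a, ha, _, ⟨m, hm, rfl⟩, hR⟩ := hconn _ (Set.Nonempty.image f ⟨0, n.succ_pos⟩) hproper
      simp only [Set.mem_image, Set.mem_Iio, not_exists, not_and] at ha hm
      refine ⟨Function.update f (n + 1) a, by simp [hf0], ?_, ?_⟩
      · intro x hx y hy hxy
        have hxy_inj := @hinj x
        simp only [Set.mem_Iio, Function.update_apply] at *
        grind
      · intro j hj hpos
        rcases Nat.lt_succ_iff_lt_or_eq.1 hj with hlt | rfl
        · obtain ⟨l, hl, hRl⟩ := hf j hlt hpos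
          refine ⟨l, hl, ?_⟩
          rwa [Function.update_of_ne (by omega), Function.update_of_ne (by omega)]
        · refine ⟨m, hm, ?_⟩
          rwa [Function.update_self, Function.update_of_ne (by omega)]
  obtain ⟨f, hf0, hinj, hf⟩ := hprefix (k - 1) (by omega)
  rw [Nat.sub_add_cancel hk] at hinj hf
  have hbij : Function.Bijective fun j : Fin k => f j :=
    Finite.injective_iff_bijective.1 fun a b hab => Fin.ext (hinj a.isLt b.isLt hab)
  refine ⟨Equiv.ofBijective _ hbij, hf0, fun j hj => ?_⟩
  obtain ⟨m, hm, hR⟩ := hf j j.isLt hj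
  exact ⟨⟨m, hm.trans j.isLt⟩, hm, hR⟩

/-- **Chain reordering lemma** (Liu–Austern, Lemma C.2).  Let `G` be a graph on the index
set, and suppose `(i₁,…,i_k)` is a tuple with `i₂ ∈ N(i₁)`, …, `i_k ∈ N(i_{1:(k-1)})`.
Then for any `1 ≤ h ≤ k` there is a permutation `π` of `{1,…,k}` with `π(1) = h` such that
`i_{π(2)} ∈ N(i_{π(1)})`, …, `i_{π(k)} ∈ N(i_{π(1)},…,i_{π(k-1)})`. -/
theorem chain_reordering {ι : Type*} [Fintype ι] [DecidableEq ι] (G : SimpleGraph ι)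
    [DecidableRel G.Adj] (k : ℕ) (hk : 2 ≤ k) (i : Fin k → ι)
    (hchain : ∀ j : Fin k, 0 < (j : ℕ) →
      i j ∈ graphNbhd G ((Finset.univ.filter fun m : Fin k => m < j).image i))
    (h : Fin k) :
    ∃ π : Equiv.Perm (Fin k), π ⟨0, by omega⟩ = h ∧
      ∀ j : Fin k, 0 < (j : ℕ) →
        i (π j) ∈ graphNbhd G
          ((Finset.univ.filter fun m : Fin k => m < j).image (fun a => i (π a))) := by
  simp only [mem_graphNbhd_image_iff, Finset.mem_filter, Finset.mem_univ, true_and] at hchain ⊢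
  exact exists_perm_chain_of_connected
    (R := fun a b => i a = i b ∨ G.Adj (i a) (i b))
    (fun _ => exists_rel_notMem_of_chain
      (fun _ _ => Or.imp Eq.symm SimpleGraph.Adj.symm) hchain) h (by omega)
end

section
/- For every integer j ≥ 2, the function P_j(x) := L_j(0, 1, x, x², …, x^{2j−2}) is a polynomial in x of degree at most j(j−1) containing only even-degree monomials, and its constant term b_0^{(j)} is an even positive integer; in particular b_0^{(j)} ≥ 2. -/
noncomputable section

/-- The partial exponential Bell polynomial `B_{n,j}(x₁,…,x_{n-j+1})` (the argument `x r`
stands for `x_{r+1}`). -/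
def bellPartial (n j : ℕ) (x : ℕ → ℝ) : ℝ :=
  ∑ i ∈ (Finset.Nat.antidiagonalTuple (n - j + 1) j).filter
      (fun i => ∑ r : Fin (n - j + 1), ((r : ℕ) + 1) * i r = n),
    ((n.factorial : ℝ) / ∏ r : Fin (n - j + 1), ((i r).factorial : ℝ)) *
      ∏ r : Fin (n - j + 1), (x (r : ℕ) / (((r : ℕ) + 1).factorial : ℝ)) ^ i r

/-- The complete exponential Bell polynomial `B_n(x₁,…,x_n)`, with `B₀ = 1`. -/
def bellComplete (n : ℕ) (x : ℕ → ℝ) : ℝ :=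
  if n = 0 then 1 else ∑ j ∈ Finset.Icc 1 n, bellPartial n j x

/-- The `(j+1) × (j+1)` Hankel determinant `H_j(x₀,…,x_{2j})`. -/
def hankelDet (j : ℕ) (x : ℕ → ℝ) : ℝ :=
  (Matrix.of fun a b : Fin (j + 1) => x ((a : ℕ) + (b : ℕ))).det

/-- `L_j(x₁,…,x_{2j}) := H_j(1, B₁(x₁), B₂(x₁,x₂), …, B_{2j}(x₁,…,x_{2j}))`. -/
def Lpoly (j : ℕ) (x : ℕ → ℝ) : ℝ := hankelDet j fun m => bellComplete m x

/-- `P_j(x) := L_j(0, 1, x, x², …, x^{2j-2})`. -/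
def Ppoly (j : ℕ) (x : ℝ) : ℝ :=
  Lpoly j fun r => if r = 0 then 0 else x ^ (r - 1)

end

open PowerSeries in
theorem coeff_pow_eq_of_coeff_eq {R : Type*} [CommRing R] {f g : PowerSeries R} {m : ℕ}
    (h : ∀ i < m, coeff i f = coeff i g) (j : ℕ) {i : ℕ} (hi : i < m) :
    coeff i (f ^ j) = coeff i (g ^ j) := by
  have hd : (X : PowerSeries R) ^ m ∣ f ^ j - g ^ j :=
    (X_pow_dvd_iff.mpr fun i hi => by simp [h i hi]).trans (sub_dvd_pow_sub_pow f g j)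
  have := X_pow_dvd_iff.mp hd i hi
  simpa [sub_eq_zero] using this

open PowerSeries in
/-- The partial Bell polynomials are the Taylor coefficients of the divided powers of the
exponential generating function of their arguments. -/
theorem bellPartial_eq_coeff_pow {n j : ℕ} (hjn : j ≤ n) (x : ℕ → ℝ) :
    bellPartial n j x = n.factorial / j.factorial *
      coeff n ((X * PowerSeries.mk fun r => x r / (r + 1).factorial : PowerSeries ℝ) ^ j) := by
  have htrunc : coeff n ((X * PowerSeries.mk fun r => x r / (r + 1).factorial :
        PowerSeries ℝ) ^ j) =
      coeff n ((∑ r : Fin (n - j + 1),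
        monomial ((r : ℕ) + 1) (x r / ((r : ℕ) + 1).factorial)) ^ j) := by
    have hX : (∑ r : Fin (n - j + 1),
        monomial ((r : ℕ) + 1) (x r / ((r : ℕ) + 1).factorial) : PowerSeries ℝ) =
        X * ∑ r : Fin (n - j + 1), monomial (r : ℕ) (x r / ((r : ℕ) + 1).factorial) := by
      rw [Finset.mul_sum]
      refine Finset.sum_congr rfl fun r _ => ?_
      ext i
      cases i <;> simp [coeff_succ_X_mul, coeff_monomial]
    obtain ⟨d, rfl⟩ := Nat.exists_eq_add_of_le hjn
    rw [hX, mul_pow, mul_pow, add_comm j d, coeff_X_pow_mul, coeff_X_pow_mul]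
    refine coeff_pow_eq_of_coeff_eq (m := d + 1) (fun i hi => ?_) j (Nat.lt_succ_self d)
    rw [map_sum, coeff_mk]
    simp only [coeff_monomial]
    refine ((Finset.sum_eq_single (⟨i, by omega⟩ : Fin (d + j - j + 1)) ?_ ?_).trans ?_).symm
    · exact fun r _ hr => if_neg fun h => hr (Fin.ext h.symm)
    · simp
    · simp
  have hmon (i : Fin (n - j + 1) → ℕ) :
      (∏ r : Fin (n - j + 1),
        (monomial ((r : ℕ) + 1) (x r / ((r : ℕ) + 1).factorial) : PowerSeries ℝ) ^ i r) =
      monomial (∑ r : Fin (n - j + 1), ((r : ℕ) + 1) * i r)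
        (∏ r : Fin (n - j + 1), (x r / ((r : ℕ) + 1).factorial : ℝ) ^ i r) := by
    have hpow (m k : ℕ) (c : ℝ) :
        (monomial m c : PowerSeries ℝ) ^ k = monomial (m * k) (c ^ k) := by
      simp only [monomial_eq_C_mul_X_pow, mul_pow, map_pow, pow_mul]
    simp only [hpow]
    induction (Finset.univ : Finset (Fin (n - j + 1))) using Finset.cons_induction with
    | empty => simp
    | cons a s ha ih => simp only [Finset.prod_cons, Finset.sum_cons, ih, monomial_mul_monomial]
  rw [htrunc, Finset.sum_pow_eq_sum_piAntidiag, map_sum, bellPartial, Finset.sum_filter,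
    Finset.mul_sum]
  have hs : Finset.Nat.antidiagonalTuple (n - j + 1) j = Finset.piAntidiag Finset.univ j := by
    ext i; simp [Finset.Nat.mem_antidiagonalTuple]
  rw [hs]
  refine Finset.sum_congr rfl fun i hi => ?_
  have hsum : ∑ r, i r = j := (Finset.mem_piAntidiag.mp hi).1
  rw [hmon, ← nsmul_eq_mul, map_nsmul, coeff_monomial]
  have hm : (∏ r, ((i r).factorial : ℝ)) * (Nat.multinomial Finset.univ i : ℝ) =
      j.factorial := by
    have := Nat.multinomial_spec Finset.univ i
    rw [hsum] at this
    exact_mod_cast this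
  have hne : (∏ r, ((i r).factorial : ℝ)) ≠ 0 := by positivity
  have hj : (j.factorial : ℝ) ≠ 0 := by positivity
  by_cases h : ∑ r : Fin (n - j + 1), ((r : ℕ) + 1) * i r = n
  · simp only [h, if_true, nsmul_eq_mul, ← mul_assoc]
    congr 1
    field_simp
    linear_combination -hm
  · simp [h, Ne.symm h]

open PowerSeries in
theorem coeff_pow_of_lt {f : PowerSeries ℝ} (hf : constantCoeff f = 0) {n j : ℕ} (h : n < j) :
    coeff n (f ^ j) = 0 :=
  X_pow_dvd_iff.mp (pow_dvd_pow_of_dvd (X_dvd_iff.mpr hf) j) n h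

open PowerSeries in
theorem bellComplete_eq_sum_coeff_pow {n N : ℕ} (hN : n < N) (x : ℕ → ℝ) :
    bellComplete n x = n.factorial * ∑ j ∈ Finset.range N, (j.factorial : ℝ)⁻¹ *
      coeff n ((X * PowerSeries.mk fun r => x r / (r + 1).factorial : PowerSeries ℝ) ^ j) := by
  have hle : Finset.range (n + 1) ⊆ Finset.range N := Finset.range_mono hN
  rw [← Finset.sum_subset hle fun j _ hj => by
    rw [coeff_pow_of_lt (by simp) (by simpa using hj), mul_zero]]
  unfold bellComplete
  split_ifs with h0
  · simp [h0]
  · rw [Finset.range_eq_Ico, Finset.sum_eq_sum_Ico_succ_bot (Nat.succ_pos n)]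
    simp only [pow_zero, coeff_one, h0, if_false, mul_zero, zero_add, Finset.mul_sum]
    refine Finset.sum_congr rfl fun j hj => ?_
    rw [bellPartial_eq_coeff_pow (Finset.mem_Icc.mp hj).2]
    ring

/-- The exponential generating function of the complete Bell polynomials. -/
noncomputable def bellSeries (x : ℕ → ℝ) : PowerSeries ℝ :=
  PowerSeries.mk fun n => bellComplete n x / n.factorial

open PowerSeries in
theorem derivative_bellSeries (x : ℕ → ℝ) :
    derivative ℝ (bellSeries x) =
      bellSeries x * (PowerSeries.mk fun r => x r / r.factorial) := by
  set K : PowerSeries ℝ := X * PowerSeries.mk fun r => x r / (r + 1).factorial with hK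
  have hdK : derivative ℝ K = PowerSeries.mk fun r => x r / r.factorial := by
    ext n
    rw [coeff_derivative, hK, coeff_succ_X_mul, coeff_mk, coeff_mk, Nat.factorial_succ]
    push_cast
    field_simp
  have hcoeff {n N : ℕ} (hN : n < N) : coeff n (bellSeries x) =
      coeff n (∑ j ∈ Finset.range N, C (j.factorial : ℝ)⁻¹ * K ^ j) := by
    rw [bellSeries, coeff_mk, bellComplete_eq_sum_coeff_pow hN, ← hK, map_sum]
    simp only [coeff_C_mul]
    field_simp
  ext n
  have hmul : coeff n (bellSeries x * derivative ℝ K) =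
      coeff n ((∑ j ∈ Finset.range (n + 1), C (j.factorial : ℝ)⁻¹ * K ^ j) *
        derivative ℝ K) := by
    rw [coeff_mul, coeff_mul]
    refine Finset.sum_congr rfl fun p hp => ?_
    rw [hcoeff (Nat.lt_succ_of_le (Finset.HasAntidiagonal.mem_antidiagonal.mp hp ▸ Nat.le_add_right _ _))]
  rw [← hdK, hmul, coeff_derivative, hcoeff (Nat.lt_succ_self (n + 1)), ← coeff_derivative]
  congr 1
  rw [Finset.sum_range_succ', map_add, map_sum, Finset.sum_mul]
  simp only [pow_zero, mul_one, derivative_C, add_zero, Derivation.leibniz, Derivation.leibniz_pow,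
    smul_eq_mul, mul_zero, Nat.add_sub_cancel]
  refine Finset.sum_congr rfl fun j _ => ?_
  have : (C ((j + 1).factorial : ℝ)⁻¹ * C ((j + 1 : ℕ) : ℝ) : PowerSeries ℝ) =
      C (j.factorial : ℝ)⁻¹ := by
    rw [← map_mul, Nat.factorial_succ]
    congr 1
    push_cast
    field_simp
  rw [← this, nsmul_eq_mul, map_natCast]
  ring

/-- The connection coefficients expressing `tⁿ` in the monic orthogonal polynomials with
three-term recurrence `t pₖ = pₖ₊₁ + x k pₖ + k pₖ₋₁` (rescaled Charlier polynomials). -/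
def charlierCoeff (x : ℝ) : ℕ → ℕ → ℝ
  | 0, 0 => 1
  | 0, _ + 1 => 0
  | n + 1, 0 => charlierCoeff x n 1
  | n + 1, k + 1 => charlierCoeff x n k + x * (k + 1) * charlierCoeff x n (k + 1) +
      (k + 2) * charlierCoeff x n (k + 2)

theorem charlierCoeff_of_lt (x : ℝ) {n k : ℕ} (h : n < k) : charlierCoeff x n k = 0 := by
  induction n generalizing k with
  | zero => obtain ⟨k, rfl⟩ := Nat.exists_eq_succ_of_ne_zero h.ne'; rfl
  | succ n ih =>
    obtain ⟨k, rfl⟩ := Nat.exists_eq_succ_of_ne_zero (by omega : k ≠ 0)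
    simp [charlierCoeff, ih (by omega : n < k), ih (by omega : n < k + 1),
      ih (by omega : n < k + 2)]

theorem charlierCoeff_self (x : ℝ) (n : ℕ) : charlierCoeff x n n = 1 := by
  induction n with
  | zero => rfl
  | succ n ih =>
    simp [charlierCoeff, ih, charlierCoeff_of_lt x (by omega : n < n + 1),
      charlierCoeff_of_lt x (by omega : n < n + 2)]

theorem sum_charlierCoeff_succ_sub (x : ℝ) (a b N : ℕ) :
    ∑ k ∈ Finset.range (N + 1), (k.factorial : ℝ) *
      (charlierCoeff x (a + 1) k * charlierCoeff x b k -
        charlierCoeff x a k * charlierCoeff x (b + 1) k) =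
    (N + 1).factorial * (charlierCoeff x a (N + 1) * charlierCoeff x b N -
      charlierCoeff x a N * charlierCoeff x b (N + 1)) := by
  induction N with
  | zero => simp [charlierCoeff]
  | succ N ih =>
    rw [Finset.sum_range_succ, ih]
    simp only [charlierCoeff, Nat.factorial_succ]
    push_cast
    ring

theorem sum_charlierCoeff_mul (x : ℝ) {a N : ℕ} (h : a ≤ N) (b : ℕ) :
    ∑ k ∈ Finset.range (N + 1), (k.factorial : ℝ) *
      (charlierCoeff x a k * charlierCoeff x b k) = charlierCoeff x (a + b) 0 := by
  induction a generalizing b with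
  | zero => simp [Finset.sum_range_succ', charlierCoeff]
  | succ a ih =>
    have hsub := sum_charlierCoeff_succ_sub x a b N
    rw [charlierCoeff_of_lt x (by omega : a < N + 1), charlierCoeff_of_lt x (by omega : a < N)]
      at hsub
    simp only [mul_sub, Finset.sum_sub_distrib, zero_mul, mul_zero, sub_zero] at hsub
    rw [sub_eq_zero.mp hsub, ih (by omega) (b + 1)]
    congr 1
    omega

theorem hankelDet_charlierCoeff (x : ℝ) (j : ℕ) :
    hankelDet j (fun m => charlierCoeff x m 0) = ∏ i : Fin (j + 1), ((i : ℕ).factorial : ℝ) := by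
  let A : Matrix (Fin (j + 1)) (Fin (j + 1)) ℝ :=
    Matrix.of fun a k => charlierCoeff x (a : ℕ) (k : ℕ)
  have hA : A.det = 1 := by
    rw [Matrix.det_of_isLowerTriangular A fun a k h => charlierCoeff_of_lt x h]
    simp [A, charlierCoeff_self]
  have hfac : (Matrix.of fun a b : Fin (j + 1) => charlierCoeff x ((a : ℕ) + (b : ℕ)) 0) =
      A * Matrix.diagonal (fun i : Fin (j + 1) => ((i : ℕ).factorial : ℝ)) * A.transpose := by
    ext a b
    rw [Matrix.of_apply, ← sum_charlierCoeff_mul x (Nat.le_of_lt_succ a.2) b,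
      ← Fin.sum_univ_eq_sum_range (fun k => (k.factorial : ℝ) *
        (charlierCoeff x a k * charlierCoeff x b k)), Matrix.mul_apply]
    refine Finset.sum_congr rfl fun k _ => ?_
    simp only [Matrix.mul_diagonal, Matrix.transpose_apply, A, Matrix.of_apply]
    ring
  rw [hankelDet, hfac, Matrix.det_mul, Matrix.det_mul, Matrix.det_transpose, hA,
    Matrix.det_diagonal]
  ring

open PowerSeries in
theorem factorial_mul_charlierCoeff {x : ℝ} {F G : PowerSeries ℝ}
    (hF0 : constantCoeff F = 1) (hG0 : constantCoeff G = 0)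
    (hF : derivative ℝ F = F * G) (hG : derivative ℝ G = 1 + C x * G) (n k : ℕ) :
    k.factorial * charlierCoeff x n k = n.factorial * coeff n (F * G ^ k) := by
  induction n generalizing k with
  | zero => cases k <;> simp [charlierCoeff, hF0, hG0]
  | succ n ih =>
    have hstep (f : PowerSeries ℝ) : ((n + 1).factorial : ℝ) * coeff (n + 1) f =
        n.factorial * coeff n (derivative ℝ f) := by
      rw [coeff_derivative, Nat.factorial_succ]
      push_cast
      ring
    rw [hstep]
    cases k with
    | zero =>
      have := ih 1
      simp only [pow_one, Nat.factorial_one, Nat.cast_one, one_mul] at this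
      simp [charlierCoeff, hF, this]
    | succ k =>
      have hd : derivative ℝ (F * G ^ (k + 1)) = F * G ^ (k + 2) +
          C ((k : ℝ) + 1) * (F * G ^ k) + C (((k : ℝ) + 1) * x) * (F * G ^ (k + 1)) := by
        have hC : (C ((k : ℝ) + 1) : PowerSeries ℝ) = (k : PowerSeries ℝ) + 1 := by simp
        simp only [map_mul, hC, Derivation.leibniz, Derivation.leibniz_pow, hF, hG, smul_eq_mul, nsmul_eq_mul,
          Nat.add_sub_cancel]
        push_cast
        ring
      have h0 := ih k
      have h1 := ih (k + 1)
      have h2 := ih (k + 2)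
      rw [hd]
      rw [map_add, map_add, coeff_C_mul, coeff_C_mul]
      simp only [charlierCoeff]
      simp only [Nat.factorial_succ] at h1 h2 ⊢
      push_cast at h1 h2 ⊢
      linear_combination ((k : ℝ) + 1) * h0 + ((k : ℝ) + 1) * x * h1 + h2

open PowerSeries in
theorem bellComplete_eq_charlierCoeff (x : ℝ) (n : ℕ) :
    bellComplete n (fun r => if r = 0 then 0 else x ^ (r - 1)) = charlierCoeff x n 0 := by
  have h := factorial_mul_charlierCoeff (x := x)
    (F := bellSeries fun r => if r = 0 then 0 else x ^ (r - 1))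
    (by simp [bellSeries, bellComplete]) (by simp) (derivative_bellSeries _)
    (by
      ext m
      rcases m with _ | m
      · simp [coeff_derivative]
      · simp only [coeff_derivative, coeff_mk, map_add, coeff_C_mul, coeff_one, Nat.factorial_succ]
        simp
        field_simp
        ring) n 0
  simp only [Nat.factorial_zero, Nat.cast_one, one_mul, pow_zero, mul_one, bellSeries,
    coeff_mk] at h
  rw [h]
  field_simp

/-- `P_j` is constant, equal to the superfactorial of `j`. -/
theorem Ppoly_eq_prod_factorial (j : ℕ) (x : ℝ) :
    Ppoly j x = ∏ i : Fin (j + 1), ((i : ℕ).factorial : ℝ) := by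
  simp only [Ppoly, Lpoly, bellComplete_eq_charlierCoeff, hankelDet_charlierCoeff]

/-- **Structure of `P_j`** (Liu–Austern, Lemma A.9).  For every `j ≥ 2`, `P_j` is a
polynomial of degree at most `j(j-1)` with only even-degree monomials, and its constant
term `b₀⁽ʲ⁾` is an even positive integer; in particular `b₀⁽ʲ⁾ ≥ 2`. -/
theorem ppoly_structure (j : ℕ) (hj : 2 ≤ j) :
    ∃ Q : Polynomial ℝ,
      (∀ x : ℝ, Ppoly j x = Q.eval x) ∧
      Q.natDegree ≤ j * (j - 1) ∧
      (∀ m : ℕ, Odd m → Q.coeff m = 0) ∧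
      ∃ b : ℤ, Q.coeff 0 = (b : ℝ) ∧ Even b ∧ 0 < b ∧ 2 ≤ b := by
  have hpos : 0 < ∏ i : Fin (j + 1), (i : ℕ).factorial :=
    Finset.prod_pos fun i _ => Nat.factorial_pos _
  have heven : 2 ∣ ∏ i : Fin (j + 1), (i : ℕ).factorial :=
    Finset.dvd_prod_of_mem (fun i : Fin (j + 1) => (i : ℕ).factorial)
      (Finset.mem_univ (⟨2, by omega⟩ : Fin (j + 1)))
  refine ⟨Polynomial.C (∏ i : Fin (j + 1), ((i : ℕ).factorial : ℝ)), fun x => ?_, ?_, ?_,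
    ((∏ i : Fin (j + 1), (i : ℕ).factorial : ℕ) : ℤ), ?_, ?_, ?_, ?_⟩
  · rw [Polynomial.eval_C, Ppoly_eq_prod_factorial]
  · rw [Polynomial.natDegree_C]
    exact Nat.zero_le _
  · exact fun m hm => Polynomial.coeff_C_of_ne_zero hm.pos.ne'
  · rw [Polynomial.coeff_C_zero]
    push_cast
    rfl
  · exact_mod_cast even_iff_two_dvd.mpr heven
  · exact_mod_cast hpos
  · exact_mod_cast Nat.le_of_dvd hpos heven
end
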